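/- Let 𝔤 = 𝒜₃,₉ ⊕ 𝒜₁ be the 4-dimensional real Lie algebra with brackets [e₁,e₂] = e₃, [e₂,e₃] = e₁, [e₃,e₁] = e₂ (so 𝔤 ≅ 𝔰𝔲(2) ⊕ ℝ). Then for every inner product g on 𝔤 and every alternating 2-form F on 𝔤 such that (g,F) is a solution of the Einstein–Maxwell equations, the metric g is Einstein. -/

import Mathlib

open scoped BigOperators

noncomputable section

/-- The underlying vector space `ℝ⁴` of the 4-dimensional Lie algebra. -/
abbrev V4 : Type := Fin 4 → ℝ

/-- The standard basis `e₁, e₂, e₃, e₄` (0-indexed). -/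
def ee (i : Fin 4) : V4 := Pi.single i 1

/-- `g` is an inner product: a positive-definite symmetric bilinear form. -/
structure IsInnerProduct (g : V4 → V4 → ℝ) : Prop where
  symm : ∀ x y, g x y = g y x
  add_left : ∀ x y z, g (x + y) z = g x z + g y z
  smul_left : ∀ (a : ℝ) (x y : V4), g (a • x) y = a * g x y
  pos : ∀ x : V4, x ≠ 0 → 0 < g x x

/-- `F` is an alternating bilinear 2-form. -/
structure IsAltForm (F : V4 → V4 → ℝ) : Prop where
  skew : ∀ x y, F x y = - F y x
  add_left : ∀ x y z, F (x + y) z = F x z + F y z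
  smul_left : ∀ (a : ℝ) (x y : V4), F (a • x) y = a * F x y

/-- Chevalley–Eilenberg differential of a 2-form with respect to the bracket `br`:
`dF(x,y,z) = −F([x,y],z) + F([x,z],y) − F([y,z],x)`. -/
def cdiff (br : V4 → V4 → V4) (F : V4 → V4 → ℝ) (x y z : V4) : ℝ :=
  - F (br x y) z + F (br x z) y - F (br y z) x

/-- A 2-form is closed if its Chevalley–Eilenberg differential vanishes. -/
def IsClosedForm (br : V4 → V4 → V4) (F : V4 → V4 → ℝ) : Prop :=
  ∀ x y z, cdiff br F x y z = 0

/-- The Gram matrix of a bilinear form in the standard basis. -/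
def gram (g : V4 → V4 → ℝ) : Matrix (Fin 4) (Fin 4) ℝ :=
  Matrix.of fun i j => g (ee i) (ee j)

/-- The inverse Gram matrix. -/
def ginv (g : V4 → V4 → ℝ) : Matrix (Fin 4) (Fin 4) ℝ := (gram g)⁻¹

/-- The inner product induced by `g` on 2-forms:
`⟨α,β⟩ = (1/2) Σ g^{ik} g^{jl} α_{ij} β_{kl}`. -/
def formInner (g : V4 → V4 → ℝ) (α β : V4 → V4 → ℝ) : ℝ :=
  (1 / 2) * ∑ i, ∑ j, ∑ k, ∑ l,
    ginv g i k * ginv g j l * α (ee i) (ee j) * β (ee k) (ee l)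

/-- The volume form of `g` for the orientation `e¹∧e²∧e³∧e⁴`. -/
def vol (g : V4 → V4 → ℝ) (x y z w : V4) : ℝ :=
  Real.sqrt (gram g).det * Matrix.det (Matrix.of fun i j => ![x, y, z, w] i j)

/-- The wedge product of two 2-forms, as a 4-form. -/
def wedge22 (α β : V4 → V4 → ℝ) (x y z w : V4) : ℝ :=
  α x y * β z w - α x z * β y w + α x w * β y z
    + α z w * β x y - α y w * β x z + α y z * β x w

/-- `sF` is the Hodge star `⋆F` of `F` with respect to `g` and the orientation
`e¹∧e²∧e³∧e⁴`: it is the 2-form with `α ∧ sF = ⟨α,F⟩_g vol_g` for all 2-forms `α`. -/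
def IsHodgeStar (g : V4 → V4 → ℝ) (F sF : V4 → V4 → ℝ) : Prop :=
  IsAltForm sF ∧
    ∀ α : V4 → V4 → ℝ, IsAltForm α → ∀ x y z w,
      wedge22 α sF x y z w = formInner g α F * vol g x y z w

/-- `F` is co-closed: `d(⋆F) = 0`. -/
def IsCoclosed (br : V4 → V4 → V4) (g F : V4 → V4 → ℝ) : Prop :=
  ∃ sF, IsHodgeStar g F sF ∧ IsClosedForm br sF

/-- Koszul expression: `g(∇ₓy, z) = (1/2)(g([x,y],z) − g([y,z],x) + g([z,x],y))`. -/
def koszul (br : V4 → V4 → V4) (g : V4 → V4 → ℝ) (x y z : V4) : ℝ :=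
  (1 / 2) * (g (br x y) z - g (br y z) x + g (br z x) y)

/-- The Levi-Civita product `∇ₓ y`, i.e. the unique vector with
`g(∇ₓy, z) = koszul x y z` for all `z` (computed via the inverse Gram matrix). -/
def LC (br : V4 → V4 → V4) (g : V4 → V4 → ℝ) (x y : V4) : V4 :=
  fun m => ∑ k, koszul br g x y (ee k) * ginv g k m

/-- Curvature `R(x,y)z = ∇ₓ∇_y z − ∇_y∇ₓ z − ∇_{[x,y]} z`. -/
def curv (br : V4 → V4 → V4) (g : V4 → V4 → ℝ) (x y z : V4) : V4 :=
  LC br g x (LC br g y z) - LC br g y (LC br g x z) - LC br g (br x y) z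

/-- Ricci tensor `Ric(x,y) = Σᵢ g(R(vᵢ,x)y, vᵢ)` for a `g`-orthonormal basis `(vᵢ)`,
i.e. the trace of the endomorphism `z ↦ R(z,x)y`. -/
def ricci (br : V4 → V4 → V4) (g : V4 → V4 → ℝ) (x y : V4) : ℝ :=
  ∑ i, curv br g (ee i) x y i

/-- Scalar curvature: the `g`-trace of the Ricci tensor. -/
def scal (br : V4 → V4 → V4) (g : V4 → V4 → ℝ) : ℝ :=
  ∑ a, ∑ b, ginv g a b * ricci br g (ee a) (ee b)

/-- Trace-free Ricci tensor `Ric₀ = Ric − (s/4) g`. -/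
def ricci0 (br : V4 → V4 → V4) (g : V4 → V4 → ℝ) (x y : V4) : ℝ :=
  ricci br g x y - (scal br g / 4) * g x y

/-- `g` is Einstein: `Ric₀ = 0`. -/
def IsEinstein (br : V4 → V4 → V4) (g : V4 → V4 → ℝ) : Prop :=
  ∀ x y, ricci0 br g x y = 0

/-- The endomorphism `F̂` with `g(F̂x, y) = F(x,y)` (computed via the inverse Gram matrix). -/
def fhat (g F : V4 → V4 → ℝ) (x : V4) : V4 :=
  fun m => ∑ k, F x (ee k) * ginv g k m

/-- `[F∘F]₀(x,y) = g(F̂(F̂x), y) − (1/4) tr(F̂∘F̂) g(x,y)`. -/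
def FF0 (g F : V4 → V4 → ℝ) (x y : V4) : ℝ :=
  g (fhat g F (fhat g F x)) y
    - (1 / 4) * (∑ i, fhat g F (fhat g F (ee i)) i) * g x y

/-- `(g, F)` is a solution of the Einstein--Maxwell equations:
`dF = 0`, `d(⋆F) = 0`, and `Ric₀ = −[F∘F]₀`. -/
def IsEMSolution (br : V4 → V4 → V4) (g F : V4 → V4 → ℝ) : Prop :=
  IsClosedForm br F ∧ IsCoclosed br g F ∧ ∀ x y, ricci0 br g x y = - FF0 g F x y

/-- Nijenhuis tensor `N_J(x,y) = [Jx,Jy] − J[Jx,y] − J[x,Jy] − [x,y]`. -/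
def nijenhuis (br : V4 → V4 → V4) (J : V4 →ₗ[ℝ] V4) (x y : V4) : V4 :=
  br (J x) (J y) - J (br (J x) y) - J (br x (J y)) - br x y

/-- The Lie algebra `𝒜₃,₉ ⊕ 𝒜₁ ≅ 𝔰𝔲(2) ⊕ ℝ`: `[e₁,e₂] = e₃`, `[e₂,e₃] = e₁`, `[e₃,e₁] = e₂`. -/
def brSU2 : V4 → V4 → V4 := fun x y =>
  (x 1 * y 2 - x 2 * y 1) • ee 0
    + (x 2 * y 0 - x 0 * y 2) • ee 1
    + (x 0 * y 1 - x 1 * y 0) • ee 2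

lemma sum_smul_ee (x : V4) : ∑ i, x i • ee i = x := by
  ext j
  simp [ee, Finset.sum_apply, Pi.single_apply]

/-- A function on `V4` that is additive and homogeneous is determined by its values on the
standard basis. -/
lemma eq_sum_mul_ee {f : V4 → ℝ} (hadd : ∀ x y, f (x + y) = f x + f y)
    (hsmul : ∀ (a : ℝ) x, f (a • x) = a * f x) (x : V4) : f x = ∑ i, x i * f (ee i) := by
  conv_lhs => rw [← sum_smul_ee x]
  simp only [Fin.sum_univ_four, hadd, hsmul]

lemma IsInnerProduct.zero_left {g : V4 → V4 → ℝ} (hg : IsInnerProduct g) (y : V4) :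
    g 0 y = 0 := by
  simpa using hg.smul_left 0 0 y

lemma IsInnerProduct.apply_eq_sum {g : V4 → V4 → ℝ} (hg : IsInnerProduct g) (x y : V4) :
    g x y = ∑ i, x i * ∑ j, gram g i j * y j := by
  rw [eq_sum_mul_ee (f := (g · y)) (fun a b => hg.add_left a b y)
    (fun a b => hg.smul_left a b y)]
  refine Finset.sum_congr rfl fun i _ => ?_
  rw [hg.symm, eq_sum_mul_ee (f := (g · (ee i))) (fun a b => hg.add_left a b _)
    (fun a b => hg.smul_left a b _)]
  simp only [gram, Matrix.of_apply, hg.symm (ee i), mul_comm]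

lemma IsInnerProduct.posDef_gram {g : V4 → V4 → ℝ} (hg : IsInnerProduct g) :
    (gram g).PosDef := by
  refine .of_dotProduct_mulVec_pos (Matrix.IsHermitian.ext fun i j => ?_) fun x hx => ?_
  · simp [gram, hg.symm (ee j)]
  · simpa [hg.apply_eq_sum x x, dotProduct, Matrix.mulVec] using hg.pos x hx

lemma IsAltForm.zero_left {F : V4 → V4 → ℝ} (hF : IsAltForm F) (y : V4) : F 0 y = 0 := by
  simpa using hF.smul_left 0 0 y

lemma IsAltForm.eq_zero_of_ee {F : V4 → V4 → ℝ} (hF : IsAltForm F)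
    (h : ∀ i j, F (ee i) (ee j) = 0) (x y : V4) : F x y = 0 := by
  rw [eq_sum_mul_ee (f := (F · y)) (fun a b => hF.add_left a b y)
    (fun a b => hF.smul_left a b y)]
  refine Finset.sum_eq_zero fun i _ => ?_
  rw [hF.skew, eq_sum_mul_ee (f := (F · (ee i))) (fun a b => hF.add_left a b _)
    (fun a b => hF.smul_left a b _)]
  simp [h]

/-- The form `⟨F, F⟩_g` is the trace of `P M P Mᵀ`, with `P` the inverse Gram matrix and `M` the
matrix of `F`. -/
lemma formInner_self_eq_trace (g F : V4 → V4 → ℝ) :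
    formInner g F F = (1 / 2) * (ginv g * gram F * (ginv g).transpose *
      (gram F).transpose).trace := by
  simp only [formInner, gram, Matrix.trace, Matrix.diag, Matrix.mul_apply, Matrix.transpose_apply,
    Matrix.of_apply, Fin.sum_univ_four]
  ring

open scoped MatrixOrder Matrix.Norms.L2Operator in
/-- The inner product induced by `g` on 2-forms is definite. -/
lemma IsAltForm.eq_zero_of_formInner_self {g F : V4 → V4 → ℝ} (hg : IsInnerProduct g)
    (hF : IsAltForm F) (h : formInner g F F = 0) (x y : V4) : F x y = 0 := by
  have hP : (ginv g).PosDef := hg.posDef_gram.inv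
  obtain ⟨B, hB⟩ := CStarAlgebra.nonneg_iff_eq_star_mul_self.mp hP.posSemidef.nonneg
  rw [Matrix.star_eq_conjTranspose] at hB
  have hBT : B.conjTranspose = B.transpose := Matrix.conjTranspose_eq_transpose_of_trivial B
  rw [hBT] at hB
  have hBu : IsUnit B := by
    have h1 := hP.isUnit
    rw [hB, Matrix.isUnit_iff_isUnit_det, Matrix.det_mul] at h1
    exact (Matrix.isUnit_iff_isUnit_det B).mpr (isUnit_of_mul_isUnit_right h1)
  have hBtu : IsUnit B.transpose := (Matrix.isUnit_transpose B).mpr hBu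
  have h0 : B * gram F * B.transpose = 0 := by
    rw [← Matrix.trace_mul_conjTranspose_self_eq_zero_iff,
      Matrix.conjTranspose_eq_transpose_of_trivial]
    have h2 := h
    rw [formInner_self_eq_trace, hB] at h2
    simp only [Matrix.transpose_mul, Matrix.transpose_transpose, Matrix.mul_assoc] at h2 ⊢
    rw [Matrix.trace_mul_comm] at h2
    simp only [Matrix.mul_assoc] at h2
    linarith
  have hM : gram F = 0 := by
    rw [hBtu.mul_left_eq_zero, hBu.mul_right_eq_zero] at h0
    exact h0
  exact hF.eq_zero_of_ee (fun i j => congrFun (congrFun hM i) j) x y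

/-- A closed 2-form on `𝔰𝔲(2) ⊕ ℝ` is annihilated by the central direction `e₄`. -/
lemma IsClosedForm.apply_ee_three_eq_zero {F : V4 → V4 → ℝ} (hF : IsAltForm F)
    (h : IsClosedForm brSU2 F) :
    F (ee 0) (ee 3) = 0 ∧ F (ee 1) (ee 3) = 0 ∧ F (ee 2) (ee 3) = 0 := by
  have h0 := h (ee 1) (ee 2) (ee 3)
  have h1 := h (ee 2) (ee 0) (ee 3)
  have h2 := h (ee 0) (ee 1) (ee 3)
  simp only [cdiff, brSU2, ee] at h0 h1 h2
  simp [hF.zero_left] at h0 h1 h2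
  exact ⟨h0, h1, h2⟩

lemma vol_ee_ne_zero {g : V4 → V4 → ℝ} (hg : IsInnerProduct g) :
    vol g (ee 0) (ee 1) (ee 2) (ee 3) ≠ 0 := by
  have h1 : (Matrix.of fun i j => ![ee 0, ee 1, ee 2, ee 3] i j) =
      (1 : Matrix (Fin 4) (Fin 4) ℝ) := by
    ext i j
    fin_cases i <;> fin_cases j <;> simp [ee]
  rw [vol, h1, Matrix.det_one, mul_one]
  exact (Real.sqrt_pos.mpr hg.posDef_gram.det_pos).ne'

/-- On `𝔰𝔲(2) ⊕ ℝ`, a closed and co-closed 2-form vanishes. -/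
lemma eq_zero_of_isClosedForm_of_isCoclosed {g F : V4 → V4 → ℝ} (hg : IsInnerProduct g)
    (hF : IsAltForm F) (hcl : IsClosedForm brSU2 F) (hco : IsCoclosed brSU2 g F) (x y : V4) :
    F x y = 0 := by
  obtain ⟨sF, ⟨hsF, hstar⟩, hscl⟩ := hco
  obtain ⟨f0, f1, f2⟩ := hcl.apply_ee_three_eq_zero hF
  obtain ⟨s0, s1, s2⟩ := hscl.apply_ee_three_eq_zero hsF
  have h := hstar F hF (ee 0) (ee 1) (ee 2) (ee 3)
  simp only [wedge22, f0, f1, f2, s0, s1, s2, mul_zero, zero_mul, sub_zero, add_zero] at h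
  exact hF.eq_zero_of_formInner_self hg
    ((mul_eq_zero.mp h.symm).resolve_right (vol_ee_ne_zero hg)) x y

/-- `𝒜₃,₉ ⊕ 𝒜₁ ≅ 𝔰𝔲(2) ⊕ ℝ` admits no left-invariant non-Einstein solution to the Einstein--Maxwell equations. -/
theorem stmt19 :
    ∀ g F : V4 → V4 → ℝ, IsInnerProduct g → IsAltForm F →
      IsEMSolution (brSU2) g F → IsEinstein (brSU2) g := by
  rintro g F hg hF ⟨hcl, hco, heq⟩ x y
  have hF0 := eq_zero_of_isClosedForm_of_isCoclosed hg hF hcl hco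
  have hhat : ∀ v, fhat g F v = 0 := fun v => by
    ext m
    simp [fhat, hF0]
  simp [heq, FF0, hhat, hg.zero_left]
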